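/- arXiv:2110.14099 — 3 statements merged into one kernel-verified Lean document; each statement's English description precedes it below -/
import Mathlib

section
/- Let c_1, …, c_t ∈ [0,1] and let F be a probability measure on [-1,1]. Then the function G : [0,1] → ℝ defined by G(m) = ∫_{[-1,1]} ∏_{i=1}^t (1 + β (c_i - m)) dF(β) is convex in m. -/
open MeasureTheory
open scoped BigOperators

/-- A bet of size `β ∈ [-1,1]` on a centred coin outcome never loses more than the stake. -/
lemma one_add_mul_sub_nonneg {β x m : ℝ} (hβ : β ∈ Set.Icc (-1 : ℝ) 1)
    (hx : x ∈ Set.Icc (0 : ℝ) 1) (hm : m ∈ Set.Icc (0 : ℝ) 1) : 0 ≤ 1 + β * (x - m) := by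
  have h : |β * (x - m)| ≤ 1 := by
    rw [abs_mul]
    exact mul_le_one₀ (abs_le.2 hβ) (abs_nonneg _)
      (abs_le.2 ⟨by linarith [hx.1, hm.2], by linarith [hx.2, hm.1]⟩)
  linarith [(abs_le.1 h).1]

/-- The wealth of a constant bet is a product of nonnegative affine functions of `m` with a
common slope, hence it is convex. -/
lemma convexOn_prod_one_add_mul_sub {ι : Type*} (s : Finset ι) {c : ι → ℝ} {β : ℝ}
    (hc : ∀ i, c i ∈ Set.Icc (0 : ℝ) 1) (hβ : β ∈ Set.Icc (-1 : ℝ) 1) :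
    ConvexOn ℝ (Set.Icc (0 : ℝ) 1) (fun m => ∏ i ∈ s, (1 + β * (c i - m))) := by
  classical
  induction s using Finset.induction_on with
  | empty => simpa using convexOn_const (1 : ℝ) (convex_Icc (0 : ℝ) 1)
  | insert a s ha ih =>
    simp only [Finset.prod_insert ha]
    have hlin : ConvexOn ℝ (Set.Icc (0 : ℝ) 1) (fun m => 1 + β * (c a - m)) :=
      ⟨convex_Icc 0 1, fun x _ y _ p q _ _ hpq => le_of_eq <| by
        simp only [smul_eq_mul]
        linear_combination (-(1 + β * c a)) * hpq⟩
    refine hlin.mul ih (fun m hm => one_add_mul_sub_nonneg hβ (hc a) hm)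
      (fun m hm => Finset.prod_nonneg fun i _ => one_add_mul_sub_nonneg hβ (hc i) hm) ?_
    refine MonovaryOn.symm fun x hx y hy hxy => ?_
    refine Finset.prod_le_prod (fun i _ => one_add_mul_sub_nonneg hβ (hc i) hx) fun i _ => ?_
    linarith

/-- For `c_1,…,c_t ∈ [0,1]` and a probability measure `F` on `[-1,1]`, the
wealth `G(m) = ∫ ∏_{i=1}^t (1 + β (c_i - m)) dF(β)` of the `F`-weighted
portfolio is convex in `m` on `[0,1]`. -/
theorem f_weighted_wealth_convex (t : ℕ) (c : Fin t → ℝ)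
    (hc : ∀ i, c i ∈ Set.Icc (0 : ℝ) 1)
    (F : Measure ℝ) [IsProbabilityMeasure F]
    (hF : F (Set.Icc (-1 : ℝ) 1)ᶜ = 0) :
    ConvexOn ℝ (Set.Icc (0 : ℝ) 1)
      (fun m => ∫ β, (∏ i, (1 + β * (c i - m))) ∂F) := by
  have hmem : ∀ᵐ β ∂F, β ∈ Set.Icc (-1 : ℝ) 1 := hF
  have hint (m : ℝ) : Integrable (fun β => ∏ i, (1 + β * (c i - m))) F := by
    rw [← Measure.restrict_eq_self_of_ae_mem hmem]
    exact ContinuousOn.integrableOn_compact isCompact_Icc (by fun_prop)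
  refine ⟨convex_Icc 0 1, fun x hx y hy a b ha hb hab => ?_⟩
  simp only [← integral_smul]
  refine le_of_le_of_eq ?_ (integral_add ((hint x).smul a) ((hint y).smul b))
  refine integral_mono_ae (hint _) (((hint x).smul a).add ((hint y).smul b)) ?_
  filter_upwards [hmem] with β hβ
  exact (convexOn_prod_one_add_mul_sub Finset.univ hc hβ).2 hx hy ha hb hab
end

section
/- Let t ≥ 1 and let w_1, …, w_t ∈ [0,∞)² be market gain vectors. For b ∈ [0,1] write Wealth_t(b) = ∏_{i=1}^t ( b·w_{i,1} + (1-b)·w_{i,2} ), and let b*_t ∈ [0,1] be a maximizer of Wealth_t(b). Let Wealth_t = ∫_0^1 Wealth_t(b) · (1/(π √(b(1-b)))) db denote the wealth of the Dirichlet(1/2,1/2)-weighted portfolio. Then ln( Wealth_t(b*_t) / Wealth_t ) ≤ max_{0 ≤ k ≤ t} f(b*_t, k, t), where f(b,k,t) = ln( π · b^k (1-b)^{t-k} · Γ(t+1) / ( Γ(k + 1/2) Γ(t-k + 1/2) ) ). -/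
open scoped BigOperators Real

/-- The extended-real logarithm, with the convention `ln x = -∞` for `x ≤ 0`. -/
noncomputable def elog (x : ℝ) : EReal :=
  if x ≤ 0 then ⊥ else ((Real.log x : ℝ) : EReal)

open Complex in
/-- The complex power `x ^ (k + 1/2 - 1)` of a nonnegative real `x` is the real number
`x ^ k / √x`. -/
lemma ofReal_cpow_natCast_add_half_sub_one {x : ℝ} (hx : 0 ≤ x) (k : ℕ) :
    (x : ℂ) ^ (((k + 1 / 2 : ℝ) : ℂ) - 1) = ((x ^ k / √x : ℝ) : ℂ) := by
  have hexp : (((k + 1 / 2 : ℝ) : ℂ) - 1) = ((k - 1 / 2 : ℝ) : ℂ) := by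
    push_cast
    ring
  rw [hexp, ← ofReal_cpow hx]
  congr 1
  rcases hx.eq_or_lt with rfl | hpos
  · rw [Real.sqrt_zero, div_zero, Real.zero_rpow]
    intro h
    have hodd : (2 * k : ℝ) = 1 := by linarith
    norm_cast at hodd
    omega
  · rw [Real.rpow_sub hpos, Real.rpow_natCast, Real.sqrt_eq_rpow]

/-- On `[0, 1]`, the complex Beta integrand with parameters `k + 1/2` and `m + 1/2` is real. -/
lemma betaIntegrand_half_eq_ofReal {x : ℝ} (hx : x ∈ Set.Icc (0 : ℝ) 1) (k m : ℕ) :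
    (x : ℂ) ^ (((k + 1 / 2 : ℝ) : ℂ) - 1) * (1 - (x : ℂ)) ^ (((m + 1 / 2 : ℝ) : ℂ) - 1) =
      ((x ^ k * (1 - x) ^ m / √(x * (1 - x)) : ℝ) : ℂ) := by
  rw [ofReal_cpow_natCast_add_half_sub_one hx.1,
    show (1 - (x : ℂ)) = ((1 - x : ℝ) : ℂ) by push_cast; rfl, ofReal_cpow_natCast_add_half_sub_one (sub_nonneg.2 hx.2), Real.sqrt_mul hx.1,
    ← Complex.ofReal_mul, div_mul_div_comm]

lemma intervalIntegrable_pow_mul_pow_div_sqrt (k m : ℕ) :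
    IntervalIntegrable (fun x : ℝ => x ^ k * (1 - x) ^ m / √(x * (1 - x)))
      MeasureTheory.volume 0 1 := by
  have h := Complex.betaIntegral_convergent (u := ((k + 1 / 2 : ℝ) : ℂ))
    (v := ((m + 1 / 2 : ℝ) : ℂ)) (by rw [Complex.ofReal_re]; positivity)
    (by rw [Complex.ofReal_re]; positivity)
  rw [intervalIntegrable_iff_integrableOn_Ioc_of_le zero_le_one] at h ⊢
  refine (MeasureTheory.Integrable.re h).congr ?_
  refine MeasureTheory.ae_restrict_of_forall_mem measurableSet_Ioc fun x hx => ?_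
  simp only [betaIntegrand_half_eq_ofReal (Set.Ioc_subset_Icc_self hx)]
  exact Complex.ofReal_re _

lemma integral_pow_mul_pow_div_sqrt (k m : ℕ) :
    ∫ x in (0 : ℝ)..1, x ^ k * (1 - x) ^ m / √(x * (1 - x)) =
      Real.Gamma (k + 1 / 2) * Real.Gamma (m + 1 / 2) / Real.Gamma (k + m + 1) := by
  have hbeta := ProbabilityTheory.beta_eq_betaIntegralReal (k + 1 / 2) (m + 1 / 2)
    (by positivity) (by positivity)
  have hreal : Complex.betaIntegral ((k + 1 / 2 : ℝ) : ℂ) ((m + 1 / 2 : ℝ) : ℂ) =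
      ((∫ x in (0 : ℝ)..1, x ^ k * (1 - x) ^ m / √(x * (1 - x)) : ℝ) : ℂ) := by
    rw [Complex.betaIntegral, ← intervalIntegral.integral_ofReal]
    refine intervalIntegral.integral_congr fun x hx => ?_
    rw [Set.uIcc_of_le zero_le_one] at hx
    exact betaIntegrand_half_eq_ofReal hx k m
  rw [hreal, Complex.ofReal_re, ProbabilityTheory.beta] at hbeta
  rw [← hbeta]
  ring_nf

/-- The Beta integral of `b ^ k (1 - b) ^ m` against the arcsine density. -/
lemma integral_pow_mul_pow_div_pi_mul_sqrt (k m : ℕ) :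
    ∫ x in (0 : ℝ)..1, x ^ k * (1 - x) ^ m / (π * √(x * (1 - x))) =
      Real.Gamma (k + 1 / 2) * Real.Gamma (m + 1 / 2) / (π * Real.Gamma (k + m + 1)) := by
  simp_rw [mul_comm π, ← div_div _ _ π]
  rw [intervalIntegral.integral_div, integral_pow_mul_pow_div_sqrt]

lemma intervalIntegrable_pow_mul_pow_div_pi_mul_sqrt (k m : ℕ) :
    IntervalIntegrable (fun x : ℝ => x ^ k * (1 - x) ^ m / (π * √(x * (1 - x))))
      MeasureTheory.volume 0 1 := by
  simp_rw [mul_comm π, ← div_div _ _ π]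
  exact (intervalIntegrable_pow_mul_pow_div_sqrt k m).div_const π

/-- The wealth of a constant portfolio is a combination of the monomials
`b ^ k (1 - b) ^ (t - k)`. -/
lemma prod_portfolio_eq_sum_powerset {ι : Type*} [Fintype ι] [DecidableEq ι] (w : ι → ℝ × ℝ)
    (b : ℝ) :
    ∏ i, (b * (w i).1 + (1 - b) * (w i).2) =
      ∑ s : Finset ι, ((∏ i ∈ s, (w i).1) * ∏ i ∈ sᶜ, (w i).2) *
        (b ^ s.card * (1 - b) ^ (Fintype.card ι - s.card)) := by
  rw [Finset.prod_add, Finset.powerset_univ]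
  refine Finset.sum_congr rfl fun s _ => ?_
  rw [← Finset.compl_eq_univ_sdiff, Finset.prod_mul_distrib, Finset.prod_mul_distrib,
    Finset.prod_const, Finset.prod_const, Finset.card_compl]
  ring

/-- The wealth of the mixture portfolio is at least `Wealth(b) / M` as soon as this holds for
each monomial `b ^ k (1 - b) ^ (t - k)`. -/
lemma prod_portfolio_le_mul_integral {ι : Type*} [Fintype ι] (w : ι → ℝ × ℝ)
    (hw : ∀ i, 0 ≤ (w i).1 ∧ 0 ≤ (w i).2) (b M : ℝ)
    (hM : ∀ k ≤ Fintype.card ι, b ^ k * (1 - b) ^ (Fintype.card ι - k) ≤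
      M * ∫ x in (0 : ℝ)..1, x ^ k * (1 - x) ^ (Fintype.card ι - k) / (π * √(x * (1 - x)))) :
    ∏ i, (b * (w i).1 + (1 - b) * (w i).2) ≤
      M * ∫ x in (0 : ℝ)..1,
        (∏ i, (x * (w i).1 + (1 - x) * (w i).2)) / (π * √(x * (1 - x))) := by
  classical
  simp_rw [prod_portfolio_eq_sum_powerset, Finset.sum_div, mul_div_assoc _ (_ * _) (π * _)]
  rw [intervalIntegral.integral_finsetSum fun s _ =>
    (intervalIntegrable_pow_mul_pow_div_pi_mul_sqrt _ _).const_mul _, Finset.mul_sum]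
  refine Finset.sum_le_sum fun s _ => ?_
  rw [intervalIntegral.integral_const_mul, mul_left_comm M]
  exact mul_le_mul_of_nonneg_left (hM _ s.card_le_univ)
    (mul_nonneg (Finset.prod_nonneg fun i _ => (hw i).1) (Finset.prod_nonneg fun i _ => (hw i).2))

lemma elog_mono : Monotone elog := by
  intro x y hxy
  unfold elog
  split_ifs with hx hy hy
  · exact le_rfl
  · exact bot_le
  · exact absurd (hxy.trans hy) hx
  · exact EReal.coe_le_coe_iff.2 (Real.log_le_log (not_le.1 hx) hxy)

/-- Data-dependent regret of the Dirichlet(1/2,1/2)-weighted portfolio with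
two stocks.  For market gains `w_1,…,w_t ∈ [0,∞)²`, constant rebalanced
portfolio wealth `Wealth_t(b) = ∏_i (b w_{i,1} + (1-b) w_{i,2})` with
maximizer `b* ∈ [0,1]`, and mixture wealth
`Wealth_t = ∫_0^1 Wealth_t(b) / (π √(b(1-b))) db`, we have
`ln(Wealth_t(b*) / Wealth_t) ≤ max_{0 ≤ k ≤ t} f(b*,k,t)` where
`f(b,k,t) = ln( π b^k (1-b)^{t-k} Γ(t+1) / (Γ(k+1/2) Γ(t-k+1/2)) )`. -/
theorem universal_portfolio_data_dependent_regret (t : ℕ) (ht : 1 ≤ t)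
    (w : Fin t → ℝ × ℝ) (hw : ∀ i, 0 ≤ (w i).1 ∧ 0 ≤ (w i).2)
    (bstar : ℝ) (hbstar : bstar ∈ Set.Icc (0 : ℝ) 1)
    (hmax : ∀ b ∈ Set.Icc (0 : ℝ) 1,
      (∏ i, (b * (w i).1 + (1 - b) * (w i).2))
        ≤ ∏ i, (bstar * (w i).1 + (1 - bstar) * (w i).2)) :
    elog ((∏ i, (bstar * (w i).1 + (1 - bstar) * (w i).2)) /
        ∫ b in (0 : ℝ)..1,
          (∏ i, (b * (w i).1 + (1 - b) * (w i).2)) /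
            (π * Real.sqrt (b * (1 - b))))
      ≤ (Finset.range (t + 1)).sup (fun k =>
          elog (π * bstar ^ k * (1 - bstar) ^ (t - k) * Real.Gamma (t + 1) /
            (Real.Gamma (k + 1 / 2) * Real.Gamma ((t : ℝ) - k + 1 / 2)))) := by
  set R : ℕ → ℝ := fun k => π * bstar ^ k * (1 - bstar) ^ (t - k) * Real.Gamma (t + 1) /
    (Real.Gamma (k + 1 / 2) * Real.Gamma ((t : ℝ) - k + 1 / 2)) with hR
  have hb1 : 0 ≤ 1 - bstar := sub_nonneg.2 hbstar.2
  have hgamma : ∀ k ≤ t, 0 < Real.Gamma (k + 1 / 2) * Real.Gamma ((t : ℝ) - k + 1 / 2) := by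
    intro k hk
    have hkt : (k : ℝ) ≤ t := Nat.cast_le.2 hk
    exact mul_pos (Real.Gamma_pos_of_pos (by positivity)) (Real.Gamma_pos_of_pos (by linarith))
  have hgammat : 0 < Real.Gamma (t + 1) := Real.Gamma_pos_of_pos (by positivity)
  obtain ⟨m, hm, hmR⟩ := Finset.exists_max_image (Finset.range (t + 1)) R ⟨0, by simp⟩
  have hRm : 0 ≤ R m :=
    div_nonneg (mul_nonneg (mul_nonneg (mul_nonneg Real.pi_nonneg (pow_nonneg hbstar.1 _))
      (pow_nonneg hb1 _)) hgammat.le) (hgamma m (Finset.mem_range_succ_iff.1 hm)).le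
  refine le_trans (elog_mono ?_) (Finset.le_sup (f := fun k => elog (R k)) hm)
  refine div_le_of_le_mul₀ ?_ hRm ?_
  · refine intervalIntegral.integral_nonneg zero_le_one fun x hx => ?_
    refine div_nonneg (Finset.prod_nonneg fun i _ => ?_) (by positivity)
    exact add_nonneg (mul_nonneg hx.1 (hw i).1) (mul_nonneg (sub_nonneg.2 hx.2) (hw i).2)
  · refine prod_portfolio_le_mul_integral w hw bstar (R m) fun k hk => ?_
    rw [Fintype.card_fin] at hk ⊢
    have hpos := hgamma k hk
    rw [integral_pow_mul_pow_div_pi_mul_sqrt, Nat.cast_sub hk, add_sub_cancel]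
    have hle := hmR k (Finset.mem_range_succ_iff.2 hk)
    refine le_trans (le_of_eq ?_) (mul_le_mul_of_nonneg_right hle (by positivity))
    simp only [hR]
    have hpi := Real.pi_ne_zero
    generalize Real.Gamma (k + 1 / 2) * Real.Gamma ((t : ℝ) - k + 1 / 2) = G at hpos
    generalize Real.Gamma (t + 1) = H at hgammat
    field_simp
end

section
/- Let δ ∈ (0,1) and μ ∈ [0,1]. Let X_1, X_2, … be random variables with 0 ≤ X_i ≤ 1 almost surely and E[X_i | X_1,…,X_{i-1}] = μ for every i. For each i let μ̂_i = (1/i) Σ_{j=1}^i X_j, V_i = Σ_{j=1}^i (X_j - μ̂_i)², R_i = ln( √π Γ(i+1) / ( δ Γ(i + 1/2) ) ), and ε_i = ( (4/3) i R_i + √( (16/9) i² R_i² + 8 V_i R_i (i² - 2 i R_i) ) ) / ( 2 i² - 4 i R_i ). Then with probability at least 1 - δ, simultaneously for all t with t > 2 R_t: max_{i=1,…,t} ( μ̂_i - ε_i ) ≤ μ ≤ min_{i=1,…,t} ( μ̂_i + ε_i ), where the max and min are taken over those i ≤ t with i > 2 R_i. -/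
open MeasureTheory
open scoped BigOperators Real

/-- Empirical mean `μ̂_i = (1/i) Σ_{j=1}^i X_j` of the first `i` samples. -/
noncomputable def empMean {Ω : Type*} (X : ℕ → Ω → ℝ) (i : ℕ) (ω : Ω) : ℝ :=
  (∑ j ∈ Finset.range i, X j ω) / i

/-- Empirical (unnormalized) variance `V_i = Σ_{j=1}^i (X_j - μ̂_i)²`. -/
noncomputable def empVar {Ω : Type*} (X : ℕ → Ω → ℝ) (i : ℕ) (ω : Ω) : ℝ :=
  ∑ j ∈ Finset.range i, (X j ω - empMean X i ω) ^ 2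

/-- The regret term `R_i = ln(√π Γ(i+1) / (δ Γ(i+1/2)))`. -/
noncomputable def regretBound (δ : ℝ) (i : ℕ) : ℝ :=
  Real.log (Real.sqrt π * Real.Gamma (i + 1) / (δ * Real.Gamma (i + 1 / 2)))

/-- The half-width
`ε_i = ((4/3) i R_i + √((16/9) i² R_i² + 8 V_i R_i (i² - 2 i R_i)))
        / (2 i² - 4 i R_i)`. -/
noncomputable def epsWidth {Ω : Type*} (δ : ℝ) (X : ℕ → Ω → ℝ) (i : ℕ)
    (ω : Ω) : ℝ :=
  ((4 / 3) * i * regretBound δ i +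
      Real.sqrt ((16 / 9) * (i : ℝ) ^ 2 * regretBound δ i ^ 2 +
        8 * empVar X i ω * regretBound δ i *
          ((i : ℝ) ^ 2 - 2 * i * regretBound δ i))) /
    (2 * (i : ℝ) ^ 2 - 4 * i * regretBound δ i)

/-- The rising product `(1/2)(3/2)⋯(k - 1/2)`. -/
noncomputable def halfRising (k : ℕ) : ℝ := ∏ i ∈ Finset.range k, ((i : ℝ) + 1 / 2)

lemma halfRising_zero : halfRising 0 = 1 := by simp [halfRising]

lemma halfRising_succ (k : ℕ) : halfRising (k + 1) = halfRising k * (k + 1 / 2) := by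
  simp [halfRising, Finset.prod_range_succ]

lemma halfRising_pos (k : ℕ) : 0 < halfRising k :=
  Finset.prod_pos fun i _ => by positivity

lemma halfRising_le_factorial (k : ℕ) : halfRising k ≤ k.factorial := by
  induction k with
  | zero => simp [halfRising_zero]
  | succ k ih =>
    rw [halfRising_succ, Nat.factorial_succ, mul_comm]
    push_cast
    have := halfRising_pos k
    gcongr
    norm_num

lemma Gamma_nat_add_half_eq_halfRising (k : ℕ) :
    Real.Gamma (k + 1 / 2) = halfRising k * √π := by
  induction k with
  | zero => simpa [halfRising_zero] using Real.Gamma_one_half_eq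
  | succ k ih =>
    have h : ((k + 1 : ℕ) : ℝ) + 1 / 2 = (k + 1 / 2) + 1 := by push_cast; ring
    rw [h, Real.Gamma_add_one (by positivity), ih, halfRising_succ]
    ring

lemma antitoneOn_log_ratio :
    AntitoneOn (fun x : ℝ => Real.log (x - 1 / 2) + (x - 1) * Real.log (x - 1) - x * Real.log x)
      (Set.Ici 1) := by
  refine antitoneOn_of_hasDerivWithinAt_nonpos
    (f' := fun x => 1 / (x - 1 / 2) + (Real.log (x - 1) + 1) - (Real.log x + 1))
    (convex_Ici 1) ?_ ?_ ?_
  · refine (ContinuousOn.add ?_ ?_).sub Real.continuous_mul_log.continuousOn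
    · refine ContinuousOn.log (by fun_prop) fun x hx => ?_
      have : (1 : ℝ) ≤ x := hx
      linarith
    · exact (Real.continuous_mul_log.comp (continuous_sub_right (1 : ℝ))).continuousOn
  · intro x hx
    rw [interior_Ici] at hx
    have hx1 : (1 : ℝ) < x := hx
    have h1 : HasDerivAt (fun x : ℝ => Real.log (x - 1 / 2)) (1 / (x - 1 / 2)) x :=
      ((hasDerivAt_id x).sub_const (1 / 2)).log (by simp only [id]; linarith)
    have h2 : HasDerivAt (fun x : ℝ => (x - 1) * Real.log (x - 1)) (Real.log (x - 1) + 1) x :=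
      HasDerivAt.comp_sub_const x 1 (Real.hasDerivAt_mul_log (by linarith))
    exact ((h1.add h2).sub (Real.hasDerivAt_mul_log (by linarith))).hasDerivWithinAt
  · intro x hx
    rw [interior_Ici] at hx
    have hx1 : 0 < x - 1 := sub_pos.2 hx
    have h := Real.le_log_one_add_of_nonneg (x := 1 / (x - 1)) (by positivity)
    have e : 1 + 1 / (x - 1) = x / (x - 1) := by field_simp; ring
    rw [e, Real.log_div (by linarith) hx1.ne'] at h
    have e2 : 2 * (1 / (x - 1)) / (1 / (x - 1) + 2) = 1 / (x - 1 / 2) := by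
      rw [div_eq_div_iff (by positivity) (by linarith)]
      field_simp
      ring
    rw [e2] at h
    linarith

lemma antitone_halfRising_ratio :
    Antitone fun n : ℕ => ((n : ℝ) + 1 / 2) * n ^ n / (n + 1) ^ (n + 1) := by
  have key (n : ℕ) : ((n : ℝ) + 1 / 2) * n ^ n / (n + 1) ^ (n + 1) =
      Real.exp (Real.log ((n + 1 : ℝ) - 1 / 2) + ((n + 1 : ℝ) - 1) * Real.log ((n + 1 : ℝ) - 1)
        - (n + 1) * Real.log (n + 1)) := by
    have hpow (m : ℕ) : Real.exp (m * Real.log m) = (m : ℝ) ^ m := by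
      rcases Nat.eq_zero_or_pos m with rfl | hm
      · simp
      · rw [Real.exp_nat_mul, Real.exp_log (by exact_mod_cast hm)]
    have h1 := hpow (n + 1)
    push_cast at h1
    rw [Real.exp_sub, Real.exp_add, h1, Real.exp_log (by linarith [n.cast_nonneg (α := ℝ)]),
      add_sub_cancel_right, hpow]
    ring
  intro m n hmn
  simp only [key]
  refine Real.exp_le_exp.2 (antitoneOn_log_ratio ?_ ?_ ?_)
  · simp
  · simp
  · simpa using hmn

/-- The regret of the Krichevsky–Trofimov mixture is largest on constant sequences. -/
lemma halfRising_add_mul_pow_le (k l : ℕ) :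
    halfRising (k + l) * ((k : ℝ) ^ k * (l : ℝ) ^ l) ≤
      halfRising k * halfRising l * ((k + l : ℕ) : ℝ) ^ (k + l) := by
  have hp (m : ℕ) : (0 : ℝ) < (m : ℝ) ^ m := by
    rcases Nat.eq_zero_or_pos m with rfl | hm
    · simp
    · positivity
  have hs (m : ℕ) : halfRising (m + 1) / ((m + 1 : ℕ) : ℝ) ^ (m + 1) =
      halfRising m / (m : ℝ) ^ m * (((m : ℝ) + 1 / 2) * m ^ m / (m + 1) ^ (m + 1)) := by
    have := (hp m).ne'
    rw [halfRising_succ]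
    push_cast
    field_simp
  have main : halfRising (k + l) / ((k + l : ℕ) : ℝ) ^ (k + l) ≤
      halfRising k / (k : ℝ) ^ k * (halfRising l / (l : ℝ) ^ l) := by
    induction l with
    | zero => simp [halfRising_zero]
    | succ l ih =>
      rw [← add_assoc, hs, hs, ← mul_assoc]
      have hk := halfRising_pos k
      have hl := halfRising_pos l
      exact mul_le_mul ih (antitone_halfRising_ratio (Nat.le_add_left l k)) (by positivity)
        (by have := hp k; have := hp l; positivity)
  rw [div_mul_div_comm, div_le_div_iff₀ (hp _) (mul_pos (hp _) (hp _))] at main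
  exact main

lemma pow_mul_pow_le_of_add_eq_one {b c : ℝ} (hb : 0 ≤ b) (hc : 0 ≤ c) (hbc : b + c = 1)
    (k l : ℕ) :
    b ^ k * c ^ l * ((k + l : ℕ) : ℝ) ^ (k + l) ≤ (k : ℝ) ^ k * (l : ℝ) ^ l := by
  have key (m : ℕ) (x : ℝ) (hx : 0 ≤ x) : x ^ m ≤ (m : ℝ) ^ m * Real.exp (x - m) := by
    rcases Nat.eq_zero_or_pos m with rfl | hm
    · simpa using hx
    · have hm' : (0 : ℝ) < m := by exact_mod_cast hm
      have h := Real.add_one_le_exp (x / m - 1)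
      rw [sub_add_cancel, div_le_iff₀ hm'] at h
      calc x ^ m ≤ (Real.exp (x / m - 1) * m) ^ m := by gcongr
        _ = (m : ℝ) ^ m * Real.exp (x - m) := by
          rw [mul_pow, ← Real.exp_nat_mul, mul_comm]
          congr 2
          field_simp
  have h := mul_le_mul (key k (b * (k + l)) (by positivity)) (key l (c * (k + l)) (by positivity))
    (by positivity) (by positivity)
  have e : Real.exp (b * (k + l) - k) * Real.exp (c * (k + l) - l) = 1 := by
    rw [← Real.exp_add, Real.exp_eq_one_iff]
    linear_combination (k + l : ℝ) * hbc
  calc _ = (b * (k + l)) ^ k * (c * (k + l)) ^ l := by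
        push_cast
        rw [mul_pow, mul_pow, pow_add]
        ring
    _ ≤ _ := h
    _ = (k : ℝ) ^ k * (l : ℝ) ^ l *
        (Real.exp (b * (k + l) - k) * Real.exp (c * (k + l) - l)) := by ring
    _ = _ := by rw [e, mul_one]

lemma halfRising_mul_pow_le {b c : ℝ} (hb : 0 ≤ b) (hc : 0 ≤ c) (hbc : b + c = 1) (k l : ℕ) :
    halfRising (k + l) * (b ^ k * c ^ l) ≤ halfRising k * halfRising l := by
  have hp : (0 : ℝ) < ((k + l : ℕ) : ℝ) ^ (k + l) := by
    rcases Nat.eq_zero_or_pos (k + l) with h | hm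
    · simp [h]
    · positivity
  refine le_of_mul_le_mul_right ?_ hp
  calc _ = halfRising (k + l) * (b ^ k * c ^ l * ((k + l : ℕ) : ℝ) ^ (k + l)) := by ring
    _ ≤ halfRising (k + l) * ((k : ℝ) ^ k * (l : ℝ) ^ l) :=
      mul_le_mul_of_nonneg_left (pow_mul_pow_le_of_add_eq_one hb hc hbc k l) (halfRising_pos _).le
    _ ≤ _ := halfRising_add_mul_pow_le k l

/-- The wealth after `t` rounds of the mixture, with weights `c k l` on monomials with `k` factors
`1 + z j` and `l` factors `1 - z j`, of constantly rebalanced bets on the outcomes `z j`. -/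
noncomputable def mixtureWealth (z : ℕ → ℝ) : (ℕ → ℕ → ℝ) → ℕ → ℝ
  | c, 0 => c 0 0
  | c, t + 1 => (1 + z t) * mixtureWealth z (fun k l => c (k + 1) l) t +
      (1 - z t) * mixtureWealth z (fun k l => c k (l + 1)) t

section mixtureWealth

variable {z : ℕ → ℝ}

lemma mixtureWealth_add (c d : ℕ → ℕ → ℝ) (t : ℕ) :
    mixtureWealth z (fun k l => c k l + d k l) t = mixtureWealth z c t + mixtureWealth z d t := by
  induction t generalizing c d with
  | zero => rfl
  | succ t ih =>
    simp only [mixtureWealth]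
    rw [ih (fun k l => c (k + 1) l), ih (fun k l => c k (l + 1))]
    ring

lemma mixtureWealth_const_mul (a : ℝ) (c : ℕ → ℕ → ℝ) (t : ℕ) :
    mixtureWealth z (fun k l => a * c k l) t = a * mixtureWealth z c t := by
  induction t generalizing c with
  | zero => rfl
  | succ t ih =>
    simp only [mixtureWealth]
    rw [ih (fun k l => c (k + 1) l), ih (fun k l => c k (l + 1))]
    ring

lemma mixtureWealth_mono (hz : ∀ j, |z j| ≤ 1) {c d : ℕ → ℕ → ℝ} {t : ℕ}
    (h : ∀ k l, k + l = t → c k l ≤ d k l) : mixtureWealth z c t ≤ mixtureWealth z d t := by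
  induction t generalizing c d with
  | zero => exact h 0 0 rfl
  | succ t ih =>
    have := abs_le.1 (hz t)
    exact add_le_add
      (mul_le_mul_of_nonneg_left (ih fun k l hkl => h _ _ (by omega)) (by linarith))
      (mul_le_mul_of_nonneg_left (ih fun k l hkl => h _ _ (by omega)) (by linarith))

lemma mixtureWealth_nonneg (hz : ∀ j, |z j| ≤ 1) {c : ℕ → ℕ → ℝ} (hc : ∀ k l, 0 ≤ c k l) (t : ℕ) :
    0 ≤ mixtureWealth z c t := by
  have h := mixtureWealth_mono hz (c := fun k l => 0 * c k l) (d := c) (t := t)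
    fun k l _ => by simpa using hc k l
  rwa [mixtureWealth_const_mul, zero_mul] at h

lemma abs_mixtureWealth_le (hz : ∀ j, |z j| ≤ 1) {c : ℕ → ℕ → ℝ} {C : ℝ}
    (hc : ∀ k l, |c k l| ≤ C) (t : ℕ) : |mixtureWealth z c t| ≤ 4 ^ t * C := by
  induction t generalizing c with
  | zero => simpa [mixtureWealth] using hc 0 0
  | succ t ih =>
    have h := abs_le.1 (hz t)
    have h1 : |1 + z t| ≤ 2 := abs_le.2 ⟨by linarith, by linarith⟩
    have h2 : |1 - z t| ≤ 2 := abs_le.2 ⟨by linarith, by linarith⟩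
    simp only [mixtureWealth]
    refine (abs_add_le _ _).trans ?_
    rw [abs_mul, abs_mul]
    have h3 := mul_le_mul h1 (ih fun k l => hc (k + 1) l) (abs_nonneg _) (by norm_num)
    have h4 := mul_le_mul h2 (ih fun k l => hc k (l + 1)) (abs_nonneg _) (by norm_num)
    rw [pow_succ]
    linarith

lemma mixtureWealth_pow (b c : ℝ) (t : ℕ) :
    mixtureWealth z (fun k l => b ^ k * c ^ l) t =
      ∏ j ∈ Finset.range t, ((b + c) + (b - c) * z j) := by
  induction t with
  | zero => simp [mixtureWealth]
  | succ t ih =>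
    rw [Finset.prod_range_succ, ← ih]
    simp only [mixtureWealth]
    have h1 : (fun k l : ℕ => b ^ (k + 1) * c ^ l) = fun k l => b * (b ^ k * c ^ l) := by
      ext; ring
    have h2 : (fun k l : ℕ => b ^ k * c ^ (l + 1)) = fun k l => c * (b ^ k * c ^ l) := by
      ext; ring
    rw [h1, h2, mixtureWealth_const_mul b (fun k l => b ^ k * c ^ l),
      mixtureWealth_const_mul c (fun k l => b ^ k * c ^ l)]
    ring

end mixtureWealth

/-- The Krichevsky–Trofimov weights `∫ b ^ k (1 - b) ^ l` under the arcsine law. -/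
noncomputable def ktWeight (k l : ℕ) : ℝ := halfRising k * halfRising l / (k + l).factorial

lemma ktWeight_pos (k l : ℕ) : 0 < ktWeight k l := by
  have := halfRising_pos k
  have := halfRising_pos l
  unfold ktWeight
  positivity

lemma ktWeight_le_one (k l : ℕ) : ktWeight k l ≤ 1 := by
  unfold ktWeight
  rw [div_le_one (by positivity)]
  calc halfRising k * halfRising l ≤ k.factorial * l.factorial :=
        mul_le_mul (halfRising_le_factorial k) (halfRising_le_factorial l)
          (halfRising_pos l).le (by positivity)
    _ ≤ (k + l).factorial := by
      exact_mod_cast Nat.le_of_dvd (Nat.factorial_pos _)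
        (Nat.factorial_mul_factorial_dvd_factorial_add k l)

lemma ktWeight_succ_add_succ (k l : ℕ) :
    ktWeight (k + 1) l + ktWeight k (l + 1) = ktWeight k l := by
  have h : (k + 1 + l).factorial = (k + l + 1) * (k + l).factorial := by
    rw [← Nat.factorial_succ]; congr 1; ring
  have h' : (k + (l + 1)).factorial = (k + l + 1) * (k + l).factorial := Nat.factorial_succ _
  unfold ktWeight
  rw [h, h', halfRising_succ, halfRising_succ]
  push_cast
  have : ((k + l).factorial : ℝ) ≠ 0 := by positivity
  have : (k : ℝ) + l + 1 ≠ 0 := by positivity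
  field_simp
  ring

lemma mixtureWealth_ktWeight_succ (z : ℕ → ℝ) (t : ℕ) :
    mixtureWealth z ktWeight (t + 1) = mixtureWealth z ktWeight t +
      mixtureWealth z (fun k l => ktWeight (k + 1) l + -1 * ktWeight k (l + 1)) t * z t := by
  have h := mixtureWealth_add (z := z) (fun k l => ktWeight (k + 1) l)
    (fun k l => ktWeight k (l + 1)) t
  simp only [ktWeight_succ_add_succ] at h
  change mixtureWealth z ktWeight t = _ at h
  rw [mixtureWealth_add (fun k l => ktWeight (k + 1) l) (fun k l => -1 * ktWeight k (l + 1)),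
    mixtureWealth_const_mul (-1) (fun k l => ktWeight k (l + 1)), h]
  simp only [mixtureWealth]
  ring

lemma le_mixtureWealth_ktWeight {z : ℕ → ℝ} (hz : ∀ j, |z j| ≤ 1) {β : ℝ} (hβ : |β| ≤ 1) (t : ℕ) :
    halfRising t / t.factorial * ∏ j ∈ Finset.range t, (1 + β * z j) ≤
      mixtureWealth z ktWeight t := by
  obtain ⟨h1, h2⟩ := abs_le.1 hβ
  have e := mixtureWealth_pow (z := z) ((1 + β) / 2) ((1 - β) / 2) t
  have e' : ∏ j ∈ Finset.range t, (1 + β * z j) =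
      ∏ j ∈ Finset.range t, (((1 + β) / 2 + (1 - β) / 2) + ((1 + β) / 2 - (1 - β) / 2) * z j) :=
    Finset.prod_congr rfl fun j _ => by ring
  rw [e', ← e, ← mixtureWealth_const_mul]
  refine mixtureWealth_mono hz fun k l hkl => ?_
  subst hkl
  rw [ktWeight, div_mul_eq_mul_div]
  exact div_le_div_of_nonneg_right
    (halfRising_mul_pow_le (by linarith) (by linarith) (by ring) k l) (by positivity)

/-- Fan's inequality: a quadratic minorant of the logarithm whose linear term is exact. -/
lemma mul_add_sq_mul_le_log_one_add {z β : ℝ} (hz : |z| ≤ 1) (hβ0 : 0 ≤ β) (hβ1 : β < 1) :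
    β * z + z ^ 2 * (Real.log (1 - β) + β) ≤ Real.log (1 + β * z) := by
  obtain ⟨hz1, hz2⟩ := abs_le.1 hz
  have pos {b : ℝ} (hb : b ∈ Set.Ico (0 : ℝ) 1) : 0 < 1 - b ∧ 1 - b ≤ 1 + b * z :=
    ⟨by linarith [hb.2], by nlinarith [hb.1]⟩
  have hd {b : ℝ} (hb : b ∈ Set.Ico (0 : ℝ) 1) : HasDerivAt
      (fun b : ℝ => Real.log (1 + b * z) - (b * z + z ^ 2 * (Real.log (1 - b) + b)))
      (z / (1 + b * z) - (z + z ^ 2 * (-1 / (1 - b) + 1))) b := by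
    have := pos hb
    have h1 : HasDerivAt (fun b : ℝ => b * z) z b := hasDerivAt_mul_const z
    have h2 : HasDerivAt (fun b : ℝ => Real.log (1 + b * z)) (z / (1 + b * z)) b :=
      (h1.const_add 1).log (by linarith)
    have h3 : HasDerivAt (fun b : ℝ => Real.log (1 - b)) (-1 / (1 - b)) b :=
      ((hasDerivAt_id b).const_sub 1).log this.1.ne'
    exact h2.sub (h1.add ((h3.add (hasDerivAt_id b)).const_mul _))
  have hmono : MonotoneOn
      (fun b : ℝ => Real.log (1 + b * z) - (b * z + z ^ 2 * (Real.log (1 - b) + b)))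
      (Set.Ico 0 1) := by
    refine monotoneOn_of_hasDerivWithinAt_nonneg (convex_Ico 0 1)
      (fun b hb => (hd hb).continuousAt.continuousWithinAt)
      (fun b hb => (hd (interior_subset hb)).hasDerivWithinAt) fun b hb => ?_
    have hb' : b ∈ Set.Ico (0 : ℝ) 1 := interior_subset hb
    obtain ⟨h1, h2⟩ := pos hb'
    have e : z / (1 + b * z) - (z + z ^ 2 * (-1 / (1 - b) + 1)) =
        b * z ^ 2 * (1 / (1 - b) - 1 / (1 + b * z)) := by
      have : 1 + z * b ≠ 0 := by linarith
      field_simp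
      ring
    rw [e]
    exact mul_nonneg (mul_nonneg hb'.1 (sq_nonneg z))
      (sub_nonneg.2 (one_div_le_one_div_of_le h1 h2))
  simpa using hmono (Set.left_mem_Ico.2 one_pos) ⟨hβ0, hβ1⟩ hβ0

lemma sq_div_le_sub_log_one_add {u : ℝ} (hu : 0 ≤ u) :
    u ^ 2 / (2 + 4 / 3 * u) ≤ u - Real.log (1 + u) := by
  have hd {x : ℝ} (hx : x ∈ Set.Ici (0 : ℝ)) : HasDerivAt
      (fun x : ℝ => x - Real.log (1 + x) - x ^ 2 / (2 + 4 / 3 * x))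
      (1 - 1 / (1 + x) - (2 * x * (2 + 4 / 3 * x) - x ^ 2 * (4 / 3)) / (2 + 4 / 3 * x) ^ 2) x := by
    have hx0 : 0 ≤ x := hx
    have h1 : HasDerivAt (fun x : ℝ => Real.log (1 + x)) (1 / (1 + x)) x :=
      ((hasDerivAt_id x).const_add 1).log (by simp only [id]; positivity)
    have h2 : HasDerivAt (fun x : ℝ => x ^ 2) (2 * x) x := by simpa using hasDerivAt_pow 2 x
    have h3 : HasDerivAt (fun x : ℝ => 2 + 4 / 3 * x) (4 / 3) x := by
      simpa using ((hasDerivAt_id x).const_mul (4 / 3 : ℝ)).const_add 2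
    exact ((hasDerivAt_id x).sub h1).sub (h2.div h3 (by positivity))
  have hmono : MonotoneOn (fun x : ℝ => x - Real.log (1 + x) - x ^ 2 / (2 + 4 / 3 * x))
      (Set.Ici 0) := by
    refine monotoneOn_of_hasDerivWithinAt_nonneg (convex_Ici 0)
      (fun b hb => (hd hb).continuousAt.continuousWithinAt)
      (fun b hb => (hd (interior_subset hb)).hasDerivWithinAt) fun x hx => ?_
    have hx0 : 0 ≤ x := interior_subset hx
    have e : 1 - 1 / (1 + x) - (2 * x * (2 + 4 / 3 * x) - x ^ 2 * (4 / 3)) / (2 + 4 / 3 * x) ^ 2 =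
        (4 / 9 * x ^ 3) / ((1 + x) * (2 + 4 / 3 * x) ^ 2) := by
      have : 2 + 4 / 3 * x ≠ 0 := by positivity
      rw [eq_div_iff (by positivity)]
      field_simp
      ring
    rw [e]
    positivity
  simpa using hmono (Set.mem_Ici.2 le_rfl) hu hu

lemma sq_sum_le_of_prod_le_exp_of_nonneg {z : ℕ → ℝ} (hz : ∀ j, |z j| ≤ 1) {t : ℕ} {R : ℝ}
    (hS : 0 ≤ ∑ j ∈ Finset.range t, z j)
    (h : ∀ β : ℝ, |β| ≤ 1 → ∏ j ∈ Finset.range t, (1 + β * z j) ≤ Real.exp R) :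
    (∑ j ∈ Finset.range t, z j) ^ 2 ≤
      R * (2 * ∑ j ∈ Finset.range t, z j ^ 2 + 4 / 3 * ∑ j ∈ Finset.range t, z j) := by
  set S := ∑ j ∈ Finset.range t, z j
  set Q := ∑ j ∈ Finset.range t, z j ^ 2
  have hQ : 0 ≤ Q := Finset.sum_nonneg fun j _ => sq_nonneg _
  rcases hQ.eq_or_lt with hQ0 | hQ0
  · have hS0 : S = 0 := Finset.sum_eq_zero fun j hj => by
      simpa using (Finset.sum_eq_zero_iff_of_nonneg fun j _ => sq_nonneg (z j)).1 hQ0.symm j hj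
    rw [← hQ0, hS0]
    simp
  set u := S / Q with hu
  have hu0 : 0 ≤ u := by positivity
  have hSu : S = Q * u := by rw [hu]; field_simp
  set β := u / (1 + u) with hβ
  have hβ0 : 0 ≤ β := by positivity
  have hβ1 : β < 1 := by rw [hβ, div_lt_one (by positivity)]; linarith
  have hβu : 1 - β = (1 + u)⁻¹ := by rw [hβ]; field_simp; ring
  have hpos (j : ℕ) : 0 < 1 + β * z j := by
    nlinarith [abs_le.1 (hz j)]
  have h1 : ∑ j ∈ Finset.range t, Real.log (1 + β * z j) ≤ R := by
    rw [← Real.log_prod fun j _ => (hpos j).ne']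
    exact (Real.log_le_iff_le_exp (Finset.prod_pos fun j _ => hpos j)).2
      (h β (by rw [abs_of_nonneg hβ0]; exact hβ1.le))
  have h2 : β * S + Q * (Real.log (1 - β) + β) ≤ R := by
    refine le_trans (le_of_eq ?_) ((Finset.sum_le_sum fun j _ =>
      mul_add_sq_mul_le_log_one_add (hz j) hβ0 hβ1).trans h1)
    rw [Finset.sum_add_distrib, ← Finset.mul_sum, ← Finset.sum_mul]
  have h3 := sq_div_le_sub_log_one_add hu0
  have h4 : β * S + Q * (Real.log (1 - β) + β) = Q * (u - Real.log (1 + u)) := by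
    have : β * (1 + u) = u := by rw [hβ]; field_simp
    rw [hβu, Real.log_inv, hSu]
    linear_combination Q * this
  have h5 : Q * (u ^ 2 / (2 + 4 / 3 * u)) ≤ R := (mul_le_mul_of_nonneg_left h3 hQ).trans (h4 ▸ h2)
  rw [← mul_div_assoc, div_le_iff₀ (by positivity)] at h5
  calc S ^ 2 = Q * (Q * u ^ 2) := by rw [hSu]; ring
    _ ≤ Q * (R * (2 + 4 / 3 * u)) := mul_le_mul_of_nonneg_left h5 hQ
    _ = R * (2 * Q + 4 / 3 * S) := by rw [hSu]; ring

lemma sq_sum_le_of_prod_le_exp {z : ℕ → ℝ} (hz : ∀ j, |z j| ≤ 1) {t : ℕ} {R : ℝ}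
    (h : ∀ β : ℝ, |β| ≤ 1 → ∏ j ∈ Finset.range t, (1 + β * z j) ≤ Real.exp R) :
    (∑ j ∈ Finset.range t, z j) ^ 2 ≤
      R * (2 * ∑ j ∈ Finset.range t, z j ^ 2 + 4 / 3 * |∑ j ∈ Finset.range t, z j|) := by
  rcases le_total 0 (∑ j ∈ Finset.range t, z j) with hS | hS
  · rw [abs_of_nonneg hS]
    exact sq_sum_le_of_prod_le_exp_of_nonneg hz hS h
  · rw [abs_of_nonpos hS]
    have := sq_sum_le_of_prod_le_exp_of_nonneg (z := fun j => -z j) (t := t)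
      (by simpa using hz) (by simpa using hS) fun β hβ => by
        simpa using h (-β) (by simpa using hβ)
    simpa using this

lemma le_root_of_quadratic_le {A B C x : ℝ} (hA : 0 < A) (h : A * x ^ 2 ≤ B * x + C) :
    x ≤ (B + √(B ^ 2 + 4 * A * C)) / (2 * A) := by
  rw [le_div_iff₀ (by positivity)]
  have := Real.le_sqrt_of_sq_le (x := 2 * A * x - B) (y := B ^ 2 + 4 * A * C) (by nlinarith)
  linarith

lemma regretBound_eq (δ : ℝ) (t : ℕ) :
    regretBound δ t = Real.log (t.factorial / (δ * halfRising t)) := by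
  have h : √π ≠ 0 := by positivity
  rw [regretBound, Gamma_nat_add_half_eq_halfRising, Real.Gamma_nat_eq_factorial]
  congr 1
  rw [mul_comm (√π), ← mul_assoc, mul_div_mul_right _ _ h]

lemma exp_regretBound {δ : ℝ} (hδ0 : 0 < δ) (t : ℕ) :
    Real.exp (regretBound δ t) = t.factorial / (δ * halfRising t) := by
  have := halfRising_pos t
  rw [regretBound_eq, Real.exp_log (by positivity)]

/-- As long as the wealth of the mixture stays below `1 / δ`, the confidence interval contains
the centre of the bets. -/
lemma abs_empMean_sub_le_epsWidth {Ω : Type*} {X : ℕ → Ω → ℝ} {ω : Ω} {δ μ : ℝ} {i : ℕ}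
    (hδ0 : 0 < δ) (hz : ∀ j, |X j ω - μ| ≤ 1)
    (hW : mixtureWealth (fun j => X j ω - μ) ktWeight i ≤ 1 / δ)
    (hi : 1 ≤ i) (hR : 2 * regretBound δ i < i) :
    |empMean X i ω - μ| ≤ epsWidth δ X i ω := by
  have hi0 : (0 : ℝ) < i := by exact_mod_cast hi
  have hprod : ∀ β : ℝ, |β| ≤ 1 →
      ∏ j ∈ Finset.range i, (1 + β * (X j ω - μ)) ≤ Real.exp (regretBound δ i) := by
    intro β hβ
    have h := (le_mixtureWealth_ktWeight hz hβ i).trans hW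
    have := halfRising_pos i
    rw [exp_regretBound hδ0, le_div_iff₀ (by positivity)]
    rw [div_mul_eq_mul_div, div_le_div_iff₀ (by positivity) hδ0] at h
    linarith
  have h := sq_sum_le_of_prod_le_exp hz hprod
  set d := empMean X i ω - μ with hd
  have hsum : ∑ j ∈ Finset.range i, X j ω = i * empMean X i ω := by
    rw [empMean]; field_simp
  have hS : ∑ j ∈ Finset.range i, (X j ω - μ) = i * d := by
    rw [Finset.sum_sub_distrib, hsum]
    simp only [Finset.sum_const, Finset.card_range, nsmul_eq_mul]
    ring
  have hQ : ∑ j ∈ Finset.range i, (X j ω - μ) ^ 2 = empVar X i ω + i * d ^ 2 := by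
    have e (j : ℕ) : (X j ω - μ) ^ 2 =
        (X j ω - empMean X i ω) ^ 2 + (2 * d * (X j ω - μ) - d ^ 2) := by rw [hd]; ring
    simp only [e]
    rw [Finset.sum_add_distrib, Finset.sum_sub_distrib, ← Finset.mul_sum, hS, empVar]
    simp only [Finset.sum_const, Finset.card_range, nsmul_eq_mul]
    ring
  rw [hS, hQ, abs_mul, abs_of_pos hi0] at h
  set R := regretBound δ i
  have hA : 0 < (i : ℝ) ^ 2 - 2 * i * R := by nlinarith
  refine (le_root_of_quadratic_le (B := 4 / 3 * i * R) (C := 2 * empVar X i ω * R) hA ?_).trans_eq ?_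
  · rw [sq_abs]
    linarith
  · rw [epsWidth]
    congr 1
    · congr 2
      ring
    · ring

section Probability

variable {Ω : Type*} {m0 : MeasurableSpace Ω} {P : Measure Ω}

lemma stronglyMeasurable_mixtureWealth {m : MeasurableSpace Ω} {Z : ℕ → Ω → ℝ} {t : ℕ}
    (hZ : ∀ j < t, StronglyMeasurable[m] (Z j)) (c : ℕ → ℕ → ℝ) :
    StronglyMeasurable[m] fun ω => mixtureWealth (fun j => Z j ω) c t := by
  induction t generalizing c with
  | zero => exact stronglyMeasurable_const
  | succ t ih =>
    have h := fun c => ih (fun j hj => hZ j (hj.trans t.lt_succ_self)) c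
    have ht := hZ t t.lt_succ_self
    exact ((stronglyMeasurable_const.add ht).mul (h _)).add
      ((stronglyMeasurable_const.sub ht).mul (h _))

/-- **Ville's inequality** for nonnegative martingales. -/
theorem measure_exists_inv_le_le [IsFiniteMeasure P] {ℱ : Filtration ℕ m0} {M : ℕ → Ω → ℝ}
    (hM : Martingale M ℱ P) (hnonneg : 0 ≤ M) {δ : ℝ} (hδ : 0 < δ) :
    P {ω | ∃ n, 1 / δ ≤ M n ω} ≤ ENNReal.ofReal (δ * ∫ ω, M 0 ω ∂P) := by
  set s : ℕ → Set Ω := fun n =>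
    {ω | 1 / δ ≤ (Finset.range (n + 1)).sup' Finset.nonempty_range_add_one fun k => M k ω} with hs
  have hmem (n : ℕ) (ω : Ω) : ω ∈ s n ↔ ∃ k, k < n + 1 ∧ 1 / δ ≤ M k ω := by
    simp [hs, Finset.le_sup'_iff]
  have hunion : {ω | ∃ n, 1 / δ ≤ M n ω} = ⋃ n, s n := by
    ext ω
    simp only [Set.mem_iUnion, hmem]
    exact ⟨fun ⟨n, hn⟩ => ⟨n, n, n.lt_succ_self, hn⟩, fun ⟨_, k, _, hk⟩ => ⟨k, hk⟩⟩
  have hmono : Monotone s := fun m n hmn ω hω => by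
    obtain ⟨k, hk, hk'⟩ := (hmem m ω).1 hω
    exact (hmem n ω).2 ⟨k, by omega, hk'⟩
  rw [hunion, hmono.measure_iUnion]
  refine iSup_le fun n => ?_
  have h := maximal_ineq hM.submartingale hnonneg (ε := ⟨1 / δ, by positivity⟩) n
  have hint : ∫ ω in s n, M n ω ∂P ≤ ∫ ω, M 0 ω ∂P := by
    refine (setIntegral_le_integral (hM.integrable n) (ae_of_all _ (hnonneg n))).trans_eq ?_
    simpa using (hM.setIntegral_eq (Nat.zero_le n) MeasurableSet.univ).symm
  have h' : ENNReal.ofReal (1 / δ) * P (s n) ≤ ENNReal.ofReal (∫ ω, M 0 ω ∂P) := by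
    refine le_trans ?_ (h.trans (ENNReal.ofReal_le_ofReal hint))
    rw [ENNReal.ofReal, Real.toNNReal_of_nonneg (by positivity)]
    rfl
  calc P (s n) = ENNReal.ofReal δ * (ENNReal.ofReal (1 / δ) * P (s n)) := by
        rw [← mul_assoc, ← ENNReal.ofReal_mul hδ.le, mul_one_div_cancel hδ.ne', ENNReal.ofReal_one,
          one_mul]
    _ ≤ ENNReal.ofReal δ * ENNReal.ofReal (∫ ω, M 0 ω ∂P) := by gcongr
    _ = _ := (ENNReal.ofReal_mul hδ.le).symm

lemma integrable_mixtureWealth [IsFiniteMeasure P] {Z : ℕ → Ω → ℝ}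
    (hZm : ∀ j, StronglyMeasurable (Z j)) (hZ : ∀ j ω, |Z j ω| ≤ 1) {c : ℕ → ℕ → ℝ} {C : ℝ}
    (hc : ∀ k l, |c k l| ≤ C) (t : ℕ) :
    Integrable (fun ω => mixtureWealth (fun j => Z j ω) c t) P :=
  .of_bound (stronglyMeasurable_mixtureWealth (fun j _ => hZm j) c).aestronglyMeasurable
    (4 ^ t * C) (ae_of_all _ fun ω => abs_mixtureWealth_le (fun j => hZ j ω) hc t)

lemma martingale_mixtureWealth_ktWeight [IsFiniteMeasure P] {ℱ : Filtration ℕ m0}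
    {Z : ℕ → Ω → ℝ} (hZm : StronglyAdapted ℱ Z) (hZ : ∀ j ω, |Z j ω| ≤ 1)
    (hmean : ∀ i, P[Z (i + 1) | ℱ i] =ᵐ[P] 0) :
    Martingale (fun n ω => mixtureWealth (fun j => Z j ω) ktWeight (n + 1)) ℱ P := by
  have hZm' (j : ℕ) : StronglyMeasurable (Z j) := (hZm j).mono (ℱ.le j)
  have hkt (k l : ℕ) : |ktWeight k l| ≤ 1 := by
    rw [abs_of_pos (ktWeight_pos k l)]
    exact ktWeight_le_one k l
  have hmeas (n : ℕ) (c : ℕ → ℕ → ℝ) :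
      StronglyMeasurable[ℱ n] fun ω => mixtureWealth (fun j => Z j ω) c (n + 1) :=
    stronglyMeasurable_mixtureWealth
      (fun j hj => (hZm j).mono (ℱ.mono (Nat.lt_succ_iff.1 hj))) c
  refine martingale_of_condExp_sub_eq_zero_nat (fun n => hmeas n _)
    (fun n => integrable_mixtureWealth hZm' hZ hkt _) fun n => ?_
  set d : ℕ → ℕ → ℝ := fun k l => ktWeight (k + 1) l + -1 * ktWeight k (l + 1)
  set D : Ω → ℝ := fun ω => mixtureWealth (fun j => Z j ω) d (n + 1)
  have hd (k l : ℕ) : |d k l| ≤ 2 := by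
    have h1 := hkt (k + 1) l
    have h2 := hkt k (l + 1)
    rw [abs_le] at h1 h2 ⊢
    constructor <;> simp only [d] <;> linarith
  have e : ((fun ω => mixtureWealth (fun j => Z j ω) ktWeight (n + 1 + 1)) -
      fun ω => mixtureWealth (fun j => Z j ω) ktWeight (n + 1)) = D * Z (n + 1) := by
    ext ω
    simp only [Pi.sub_apply, Pi.mul_apply]
    rw [mixtureWealth_ktWeight_succ]
    ring
  have hZint : Integrable (Z (n + 1)) P :=
    .of_bound (hZm' _).aestronglyMeasurable 1 (ae_of_all _ fun ω => hZ _ ω)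
  have hDint : Integrable D P := integrable_mixtureWealth hZm' hZ hd _
  rw [e]
  have hpull := condExp_mul_of_stronglyMeasurable_left (μ := P) (hmeas n d)
    (hDint.mul_bdd (c := 1) (hZm' _).aestronglyMeasurable (ae_of_all _ fun ω => hZ _ ω)) hZint
  filter_upwards [hpull, hmean n] with ω h1 h2
  rw [h1, Pi.mul_apply, h2]
  simp

end Probability

/-- Empirical-Bernstein-type time-uniform concentration: with probability at
least `1 - δ`, simultaneously for every `t ≥ 1` with `t > 2 R_t`, all the
empirical confidence intervals `[μ̂_i - ε_i, μ̂_i + ε_i]` for `1 ≤ i ≤ t` with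
`i > 2 R_i` contain the conditional mean `μ`.  Here `X 0, X 1, …` represent
`X_1, X_2, …`, taking values in `[0,1]` a.s., with
`E[X_i | X_1,…,X_{i-1}] = μ` (so `E[X 0] = μ`, and the conditional
expectation of `X (i+1)` given the natural filtration at time `i` is `μ`). -/
theorem empirical_bernstein_time_uniform {Ω : Type*} {m0 : MeasurableSpace Ω}
    {P : Measure Ω} [IsProbabilityMeasure P]
    (X : ℕ → Ω → ℝ) (hX : ∀ i, StronglyMeasurable (X i))
    (δ μ : ℝ) (hδ0 : 0 < δ) (hδ1 : δ < 1) (hμ : μ ∈ Set.Icc (0 : ℝ) 1)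
    (hbdd : ∀ i, ∀ᵐ ω ∂P, X i ω ∈ Set.Icc (0 : ℝ) 1)
    (hmean0 : ∫ ω, X 0 ω ∂P = μ)
    (hmean : ∀ i, P[X (i + 1) | (Filtration.natural X hX) i]
      =ᵐ[P] fun _ => μ) :
    ENNReal.ofReal (1 - δ) ≤
      P {ω | ∀ t : ℕ, 1 ≤ t → 2 * regretBound δ t < t →
        ∀ i : ℕ, 1 ≤ i → i ≤ t → 2 * regretBound δ i < i →
          empMean X i ω - epsWidth δ X i ω ≤ μ ∧
            μ ≤ empMean X i ω + epsWidth δ X i ω} := by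
  set Y : ℕ → Ω → ℝ := fun i ω => max 0 (min 1 (X i ω))
  have hYX (i : ℕ) : Y i =ᵐ[P] X i := by
    filter_upwards [hbdd i] with ω hω
    simp [Y, hω.1, hω.2]
  have hY (i : ℕ) (ω : Ω) : Y i ω ∈ Set.Icc (0 : ℝ) 1 := by simp [Y]
  have hZ (i : ℕ) (ω : Ω) : |Y i ω - μ| ≤ 1 := by
    rw [abs_le]
    constructor <;> linarith [(hY i ω).1, (hY i ω).2, hμ.1, hμ.2]
  have hYad : StronglyAdapted (Filtration.natural X hX) Y := fun i =>
    (by fun_prop : Continuous fun x : ℝ => max 0 (min 1 x)).comp_stronglyMeasurable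
      (Filtration.stronglyAdapted_natural hX i)
  have hYint (i : ℕ) : Integrable (Y i) P :=
    .of_bound ((hYad i).mono (Filtration.le _ i)).aestronglyMeasurable 1
      (ae_of_all _ fun ω => by rw [Real.norm_of_nonneg (hY i ω).1]; exact (hY i ω).2)
  have hmart := martingale_mixtureWealth_ktWeight (P := P) (Z := fun i ω => Y i ω - μ)
    (fun i => (hYad i).sub stronglyMeasurable_const) hZ fun i => by
      have h1 := condExp_sub (hYint (i + 1)) (integrable_const μ) (Filtration.natural X hX i)
      rw [condExp_const (Filtration.le _ i)] at h1
      have h2 := condExp_congr_ae (m := Filtration.natural X hX i) (hYX (i + 1))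
      filter_upwards [h1, h2, hmean i] with ω e1 e2 e3
      refine e1.trans ?_
      simp [e2, e3]
  have hinit : ∫ ω, mixtureWealth (fun j => Y j ω - μ) ktWeight (0 + 1) ∂P = 1 := by
    have e (ω : Ω) : mixtureWealth (fun j => Y j ω - μ) ktWeight (0 + 1) = 1 := by
      simp [mixtureWealth, ktWeight, halfRising]
      ring
    simp [e]
  have hville := measure_exists_inv_le_le hmart
    (fun n ω => mixtureWealth_nonneg (fun j => hZ j ω) (fun k l => (ktWeight_pos k l).le) _) hδ0
  rw [hinit, mul_one] at hville
  set bad : Set Ω := {ω | ∃ n, 1 / δ ≤ mixtureWealth (fun j => Y j ω - μ) ktWeight (n + 1)}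
  have hgood : 1 - ENNReal.ofReal δ ≤ P badᶜ := by
    rw [tsub_le_iff_right, ← measure_univ (μ := P), ← Set.compl_union_self bad]
    exact (measure_union_le _ _).trans (by gcongr)
  rw [ENNReal.ofReal_sub _ hδ0.le, ENNReal.ofReal_one]
  refine hgood.trans (measure_mono_ae ?_)
  filter_upwards [ae_all_iff.2 hYX] with ω hω hbad t _ _ i hi _ hRi
  have hWi : mixtureWealth (fun j => X j ω - μ) ktWeight i ≤ 1 / δ := by
    obtain ⟨n, rfl⟩ := Nat.exists_eq_add_of_le' hi
    simp only [← hω]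
    exact (not_le.1 fun h => hbad ⟨n, h⟩).le
  have := abs_le.1 (abs_empMean_sub_le_epsWidth (X := X) hδ0
    (fun j => by rw [← hω]; exact hZ j ω) hWi hi hRi)
  constructor <;> linarith
end
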